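/- arXiv:2505.17878 — 2 statements merged into one kernel-verified Lean document; each statement's English description precedes it below -/
import Mathlib

section
/- For every k ∈ ℕ and every M ∈ ℝ, the family H^{f''/f'}_{k,M} = { f''/f' : f ∈ H_{k,M} } is locally uniformly bounded on the unit disk 𝔻. -/
open Complex Filter Set Metric Topology

noncomputable section

/-- The open unit disk `𝔻`. -/
def unitDisk : Set ℂ := Metric.ball (0 : ℂ) 1

/-- The logarithmic derivative of `f'`, i.e. `f''/f'`. -/
def ldd (f : ℂ → ℂ) : ℂ → ℂ := fun z => deriv (deriv f) z / deriv f z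

/-- `SRec n f m` is the generalized Schwarzian `S_{m+2,n}(f)`. -/
def SRec (n : ℕ) (f : ℂ → ℂ) : ℕ → ℂ → ℂ
  | 0 => ldd f
  | m + 1 => fun z => deriv (SRec n f m) z - (1 / (n : ℂ)) * ldd f z * SRec n f m z

/-- `SGen n k f` is `S_{k,n}(f)` (for `k ≥ 2`). -/
def SGen (n k : ℕ) (f : ℂ → ℂ) : ℂ → ℂ := SRec n f (k - 2)

/-- The generalized Schwarzian derivative of order `k`: `S_k(f) = S_{k+1,k}(f)`. -/
def Sk (k : ℕ) (f : ℂ → ℂ) : ℂ → ℂ := SGen k (k + 1) f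

/-- `f` is a non-constant meromorphic function on `U`: near no point of `U`
is `f` eventually equal to a constant. -/
def NonConstOn (f : ℂ → ℂ) (U : Set ℂ) : Prop :=
  ¬ ∃ c : ℂ, ∃ z ∈ U, ∀ᶠ w in 𝓝[≠] z, f w = c

/-- `E` has no accumulation point in `U`. -/
def NoAccIn (E U : Set ℂ) : Prop := ∀ z ∈ U, ¬ AccPt z (𝓟 E)

/-- The family `M_{k,M}`: (non-constant) meromorphic functions on `𝔻` whose generalized
Schwarzian derivative `S_k(f)` is holomorphic on `𝔻` with `‖S_k(f)‖_∞ ≤ M`, i.e. it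
coincides (away from a set without accumulation points in `𝔻`) with a function `g`
holomorphic on `𝔻` and bounded by `M`. -/
def MFam (k : ℕ) (M : ℝ) : Set (ℂ → ℂ) :=
  {f | MeromorphicOn f unitDisk ∧ NonConstOn f unitDisk ∧
    ∃ g : ℂ → ℂ, AnalyticOnNhd ℂ g unitDisk ∧ (∀ z ∈ unitDisk, ‖g z‖ ≤ M) ∧
      NoAccIn {w ∈ unitDisk | Sk k f w ≠ g w} unitDisk}

/-- The family `H_{k,M} = M_{k,M} ∩ H(𝔻)`. -/
def HFam (k : ℕ) (M : ℝ) : Set (ℂ → ℂ) :=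
  {f ∈ MFam k M | AnalyticOnNhd ℂ f unitDisk}

/-- The chordal (spherical) distance on the Riemann sphere `ℂ ∪ {∞}`. -/
def sphDist (x y : OnePoint ℂ) : ℝ :=
  Option.elim x (Option.elim y 0 fun w => 1 / Real.sqrt (1 + ‖w‖ ^ 2))
    fun z =>
      Option.elim y (1 / Real.sqrt (1 + ‖z‖ ^ 2)) fun w =>
        ‖z - w‖ / (Real.sqrt (1 + ‖z‖ ^ 2) * Real.sqrt (1 + ‖w‖ ^ 2))

/-- Locally uniform convergence on `U` with respect to the spherical metric. -/
def TendstoLocUnifSph (F : ℕ → ℂ → ℂ) (g : ℂ → OnePoint ℂ) (U : Set ℂ) : Prop :=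
  ∀ ε > (0 : ℝ), ∀ x ∈ U, ∃ t ∈ 𝓝[U] x,
    ∀ᶠ n in atTop, ∀ y ∈ t, sphDist (F n y : OnePoint ℂ) (g y) < ε

/-- A family of (meromorphic) functions is normal on `U` if every sequence has a
subsequence converging locally uniformly on `U` w.r.t. the spherical metric. -/
def NormalOn (𝓕 : Set (ℂ → ℂ)) (U : Set ℂ) : Prop :=
  ∀ F : ℕ → ℂ → ℂ, (∀ n, F n ∈ 𝓕) →
    ∃ φ : ℕ → ℕ, StrictMono φ ∧
      ∃ g : ℂ → OnePoint ℂ, TendstoLocUnifSph (fun n => F (φ n)) g U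

/-- A family is quasi-normal on `U` if every sequence has a subsequence converging
locally uniformly (spherically) off some exceptional set `E ⊆ U` without
accumulation points in `U`. -/
def QuasiNormalOn (𝓕 : Set (ℂ → ℂ)) (U : Set ℂ) : Prop :=
  ∀ F : ℕ → ℂ → ℂ, (∀ n, F n ∈ 𝓕) →
    ∃ φ : ℕ → ℕ, StrictMono φ ∧ ∃ E : Set ℂ, E ⊆ U ∧ NoAccIn E U ∧
      ∃ g : ℂ → OnePoint ℂ, TendstoLocUnifSph (fun n => F (φ n)) g (U \ E)

/-- A family is locally uniformly bounded on `U`. -/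
def LocUnifBddOn (𝓕 : Set (ℂ → ℂ)) (U : Set ℂ) : Prop :=
  ∀ x ∈ U, ∃ t ∈ 𝓝[U] x, ∃ C : ℝ, ∀ f ∈ 𝓕, ∀ y ∈ t, ‖f y‖ ≤ C

/-- Growth of a holomorphic function whose `k`-th derivative is dominated by the function. -/
lemma norm_le_mul_exp_of_norm_iteratedDeriv_le {k : ℕ} (hk : 1 ≤ k) {K R N : ℝ} (hK : 1 ≤ K)
    (hR : R ≤ 1) {x : ℂ} {y : ℂ → ℂ} (hy : AnalyticOnNhd ℂ y (ball x R))
    (hode : ∀ z ∈ ball x R, ‖iteratedDeriv k y z‖ ≤ K * ‖y z‖) (hN : 0 ≤ N)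
    (h0 : ∀ j < k, ‖iteratedDeriv j y x‖ ≤ N) {z : ℂ} (hz : z ∈ ball x R) :
    ‖y z‖ ≤ N * Real.exp K := by
  have hmem : ∀ t ∈ Icc (0 : ℝ) 1, x + t * (z - x) ∈ ball x R := by
    intro t ht
    rw [mem_ball_iff_norm] at hz ⊢
    rw [add_sub_cancel_left, norm_mul, Complex.norm_real, Real.norm_of_nonneg ht.1]
    exact (mul_le_of_le_one_left (norm_nonneg _) ht.2).trans_lt hz
  have hv : ‖z - x‖ ≤ 1 := (mem_ball_iff_norm.1 hz).le.trans hR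
  let Y : ℝ → Fin k → ℂ := fun t j => iteratedDeriv j y (x + t * (z - x))
  let Y' : ℝ → Fin k → ℂ := fun t j => iteratedDeriv (j + 1) y (x + t * (z - x)) * (z - x)
  have hYd : ∀ t ∈ Icc (0 : ℝ) 1, HasDerivAt Y (Y' t) t := by
    intro t ht
    refine hasDerivAt_pi.2 fun j => ?_
    have h1 : HasDerivAt (iteratedDeriv j y) (iteratedDeriv (j + 1) y (x + t * (z - x)))
        (x + t * (z - x)) := by
      rw [iteratedDeriv_succ, iteratedDeriv_eq_iterate]
      exact ((hy _ (hmem t ht)).iterated_deriv j).differentiableAt.hasDerivAt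
    have h2 : HasDerivAt (fun s : ℝ => x + (s : ℂ) * (z - x)) (z - x) t := by
      simpa using ((Complex.ofRealCLM.hasDerivAt (x := t)).mul_const (z - x)).const_add x
    exact h1.comp t h2
  have hcomp : ∀ (t : ℝ) (j : ℕ), j < k → ‖iteratedDeriv j y (x + t * (z - x))‖ ≤ ‖Y t‖ :=
    fun t j hj => norm_le_pi_norm (Y t) ⟨j, hj⟩
  have hbound : ∀ t ∈ Ico (0 : ℝ) 1, ‖Y' t‖ ≤ K * ‖Y t‖ + 0 := by
    intro t ht
    rw [add_zero]
    refine (pi_norm_le_iff_of_nonneg (by positivity)).2 fun j => ?_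
    have h1 : ‖iteratedDeriv (j + 1) y (x + t * (z - x))‖ ≤ K * ‖Y t‖ := by
      rcases Nat.lt_or_ge (j + 1) k with hj | hj
      · exact (hcomp t _ hj).trans (le_mul_of_one_le_left (norm_nonneg _) hK)
      · have hjk : (j : ℕ) + 1 = k := le_antisymm j.2 hj
        rw [hjk]
        refine (hode _ (hmem t (Ico_subset_Icc_self ht))).trans ?_
        gcongr
        simpa using hcomp t 0 hk
    calc ‖Y' t j‖ = ‖iteratedDeriv (j + 1) y (x + t * (z - x))‖ * ‖z - x‖ := norm_mul _ _
      _ ≤ K * ‖Y t‖ * 1 := by gcongr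
      _ = K * ‖Y t‖ := mul_one _
  have hini : ‖Y 0‖ ≤ N := by
    refine (pi_norm_le_iff_of_nonneg hN).2 fun j => ?_
    simpa [Y] using h0 j j.2
  have hgr := norm_le_gronwallBound_of_norm_deriv_right_le
    (fun t ht => (hYd t ht).continuousAt.continuousWithinAt)
    (fun t ht => (hYd t (Ico_subset_Icc_self ht)).hasDerivWithinAt) hini hbound 1
    (right_mem_Icc.2 zero_le_one)
  rw [gronwallBound_ε0] at hgr
  have h1 := hcomp 1 0 hk
  simp only [iteratedDeriv_zero, ofReal_one, one_mul, add_sub_cancel] at h1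
  simpa using h1.trans hgr

/-- Bound for `h'` when `exp ∘ h` is a zero-free solution of a `k`-th order linear differential
inequality. -/
lemma exists_bound_deriv_of_norm_iteratedDeriv_exp_le {k : ℕ} (hk : 1 ≤ k) {K R : ℝ}
    (hK : 1 ≤ K) (hR0 : 0 < R) (hR : R ≤ 1) :
    ∃ C : ℝ, ∀ (x : ℂ) (h : ℂ → ℂ), DifferentiableOn ℂ h (ball x R) →
      (∀ z ∈ ball x R, ‖iteratedDeriv k (fun w => cexp (h w)) z‖ ≤ K * ‖cexp (h z)‖) →
      ∀ z ∈ ball x (R / 8), ‖deriv h z‖ ≤ C := by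
  set r := R / 8 with hr
  have hr0 : 0 < r := by positivity
  set B : ℝ := k.factorial / r ^ k * Real.exp K with hB
  have hB1 : 1 < B := by
    have h1 : (1 : ℝ) ≤ k.factorial / r ^ k := by
      rw [one_le_div (by positivity)]
      exact (pow_le_one₀ hr0.le (by linarith)).trans (by exact_mod_cast k.factorial_pos)
    exact one_lt_mul_of_le_of_lt h1 (Real.one_lt_exp_iff.2 (by linarith))
  have hA : 0 < Real.log B := Real.log_pos hB1
  refine ⟨6 * Real.log B / r, fun x h hh hode z hz => ?_⟩
  have hyd : DifferentiableOn ℂ (fun w => cexp (h w)) (ball x R) := hh.cexp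
  have hsub : closedBall x r ⊆ ball x R := closedBall_subset_ball (by linarith)
  obtain ⟨w, hw, hmax⟩ := (isCompact_closedBall x r).exists_isMaxOn
    (nonempty_closedBall.2 hr0.le) (hyd.continuousOn.norm.mono hsub)
  have hcauchy : ∀ j < k, ‖iteratedDeriv j (fun w => cexp (h w)) x‖ ≤
      k.factorial / r ^ k * ‖cexp (h w)‖ := by
    intro j hj
    refine (norm_iteratedDeriv_le_of_forall_mem_sphere_norm_le j hr0
      (hyd.diffContOnCl_ball hsub) fun ζ hζ => hmax (sphere_subset_closedBall hζ)).trans ?_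
    rw [mul_div_right_comm]
    gcongr ?_ / ?_ * _
    · exact_mod_cast Nat.factorial_le hj.le
    · exact pow_le_pow_of_le_one hr0.le (by linarith) hj.le
  have hgrow : ∀ ζ ∈ ball x R, (h ζ - h w).re ≤ Real.log B := by
    intro ζ hζ
    have h1 := norm_le_mul_exp_of_norm_iteratedDeriv_le hk hK hR
      (hyd.analyticOnNhd isOpen_ball) hode (by positivity) hcauchy hζ
    rw [Real.le_log_iff_exp_le (by linarith), ← Complex.norm_exp, Complex.exp_sub, norm_div,
      div_le_iff₀ (norm_pos_iff.2 (Complex.exp_ne_zero _))]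
    calc _ ≤ _ := h1
      _ = _ := by rw [hB]; ring
  rw [mem_closedBall_iff_norm] at hw
  rw [mem_ball_iff_norm] at hz
  have hmem : ∀ ζ ∈ ball (0 : ℂ) (4 * r), w + ζ ∈ ball x R := by
    intro ζ hζ
    rw [mem_ball_zero_iff] at hζ
    rw [mem_ball_iff_norm]
    calc ‖w + ζ - x‖ = ‖(w - x) + ζ‖ := by ring_nf
      _ ≤ ‖w - x‖ + ‖ζ‖ := norm_add_le _ _
      _ < R := by linarith
  have hbc : ∀ ζ, ‖ζ‖ ≤ 3 * r → ‖h (w + ζ) - h w‖ ≤ 6 * Real.log B := by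
    intro ζ hζ
    have hd : DifferentiableOn ℂ (fun ζ => h (w + ζ) - h w) (ball 0 (4 * r)) :=
      (hh.comp (by fun_prop) hmem).sub_const _
    refine (Complex.borelCaratheodory_zero hA hd (fun ζ hζ => hgrow _ (hmem ζ hζ))
      (by positivity) (mem_ball_zero_iff.2 (by linarith)) (by simp)).trans ?_
    rw [div_le_iff₀ (by linarith)]
    nlinarith
  have hz' : closedBall z r ⊆ ball x R := by
    refine closedBall_subset_ball' ?_
    rw [dist_eq_norm]
    linarith
  have := norm_deriv_le_of_forall_mem_sphere_norm_le (f := fun ζ => h ζ - h w)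
    (C := 6 * Real.log B) hr0 ((hh.sub_const (h w)).diffContOnCl_ball hz') fun ζ hζ => by
      rw [mem_sphere_iff_norm] at hζ
      have h1 := hbc (ζ - w) (by
        calc ‖ζ - w‖ = ‖(ζ - z) + (z - x) - (w - x)‖ := by ring_nf
          _ ≤ ‖ζ - z‖ + ‖z - x‖ + ‖w - x‖ := (norm_sub_le _ _).trans (by
              gcongr; exact norm_add_le _ _)
          _ ≤ 3 * r := by linarith)
      simpa using h1
  simpa using this

lemma SRec_analyticOnNhd {n : ℕ} {f : ℂ → ℂ} {U : Set ℂ} (hf : AnalyticOnNhd ℂ (ldd f) U)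
    (m : ℕ) : AnalyticOnNhd ℂ (SRec n f m) U := by
  induction m with
  | zero => exact hf
  | succ m ih => exact ih.deriv.sub ((analyticOnNhd_const.mul hf).mul ih)

/-- The generalized Schwarzians linearize: with `h' = -(1/n) f''/f'`, the derivatives of `exp ∘ h`
are `-(1/n) S_{m+2,n}(f) exp ∘ h`. -/
lemma iteratedDeriv_exp_eq_SRec {n : ℕ} {f h : ℂ → ℂ} {U : Set ℂ} (hU : IsOpen U)
    (hf : AnalyticOnNhd ℂ (ldd f) U)
    (hh : ∀ z ∈ U, HasDerivAt h (-(1 / (n : ℂ)) * ldd f z) z) (m : ℕ) :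
    ∀ z ∈ U, iteratedDeriv (m + 1) (fun w => cexp (h w)) z =
      -(1 / (n : ℂ)) * SRec n f m z * cexp (h z) := by
  induction m with
  | zero =>
    intro z hz
    rw [zero_add, iteratedDeriv_one, (hh z hz).cexp.deriv]
    simp only [SRec]
    ring
  | succ m ih =>
    intro z hz
    have hev : iteratedDeriv (m + 1) (fun w => cexp (h w)) =ᶠ[𝓝 z]
        fun w => -(1 / (n : ℂ)) * SRec n f m w * cexp (h w) := by
      filter_upwards [hU.mem_nhds hz] with w hw using ih w hw
    rw [iteratedDeriv_succ, hev.deriv_eq]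
    have hS := (SRec_analyticOnNhd (n := n) hf m z hz).differentiableAt.hasDerivAt
    have hd : HasDerivAt (fun w => -(1 / (n : ℂ)) * SRec n f m w * cexp (h w)) _ z :=
      (hS.const_mul (-(1 / (n : ℂ)))).mul (hh z hz).cexp
    rw [hd.deriv]
    simp only [SRec]
    ring

/-- Near a point where `f''/f'` has a simple pole with positive integer residue,
`S_{m+2,n}(f)` has a pole of exact order `m + 1`. -/
lemma exists_SRec_eq_div_pow {n : ℕ} {f : ℂ → ℂ} {a : ℂ} {p : ℕ} (hp : 1 ≤ p) {G : ℂ → ℂ}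
    (hG : AnalyticAt ℂ G a) (hGa : G a = p) (hfG : ∀ᶠ z in 𝓝[≠] a, ldd f z = G z / (z - a))
    (m : ℕ) : ∃ H : ℂ → ℂ, AnalyticAt ℂ H a ∧ H a ≠ 0 ∧
      ∀ᶠ z in 𝓝[≠] a, SRec n f m z = H z / (z - a) ^ (m + 1) := by
  induction m with
  | zero =>
    refine ⟨G, hG, ?_, by simpa [SRec] using hfG⟩
    rw [hGa]
    exact_mod_cast (by omega : p ≠ 0)
  | succ m ih =>
    obtain ⟨H, hH, hHa, hev⟩ := ih
    refine ⟨fun z => (z - a) * deriv H z - (m + 1) * H z - 1 / (n : ℂ) * G z * H z, ?_, ?_, ?_⟩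
    · have := hH.deriv
      fun_prop
    · have h1 : (a - a) * deriv H a - (m + 1) * H a - 1 / (n : ℂ) * G a * H a =
          -(((m : ℝ) + 1 + 1 / (n : ℝ) * p : ℝ) : ℂ) * H a := by
        rw [hGa]; push_cast; ring
      refine h1.trans_ne (mul_ne_zero (neg_ne_zero.2 (Complex.ofReal_ne_zero.2 ?_)) hHa)
      positivity
    · have hHan : ∀ᶠ z in 𝓝[≠] a, AnalyticAt ℂ H z :=
        hH.eventually_analyticAt.filter_mono nhdsWithin_le_nhds
      filter_upwards [hfG, eventually_eventually_nhdsWithin.2 hev, hev, hHan, self_mem_nhdsWithin]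
        with z hz1 hz2 hz3 hz4 hz5
      have hza : z - a ≠ 0 := sub_ne_zero.2 hz5
      rw [isOpen_compl_singleton.nhdsWithin_eq hz5] at hz2
      simp only [SRec]
      have hd : HasDerivAt (fun z => H z / (z - a) ^ (m + 1)) _ z :=
        hz4.differentiableAt.hasDerivAt.fun_div (((hasDerivAt_id z).sub_const a).fun_pow (m + 1))
          (pow_ne_zero _ hza)
      rw [EventuallyEq.deriv_eq hz2, hd.deriv, hz1, hz3]
      simp only [id, Nat.add_sub_cancel]
      push_cast
      field_simp
      ring

lemma eventually_eq_of_noAccIn {F G : ℂ → ℂ} {U : Set ℂ} (hU : IsOpen U)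
    (h : NoAccIn {w ∈ U | F w ≠ G w} U) {z : ℂ} (hz : z ∈ U) : ∀ᶠ w in 𝓝[≠] z, F w = G w := by
  have h1 := h z hz
  rw [accPt_iff_frequently_nhdsNE, not_frequently] at h1
  filter_upwards [h1, mem_nhdsWithin_of_mem_nhds (hU.mem_nhds hz)] with w hw hwU
  by_contra hne
  exact hw ⟨hwU, hne⟩

/-- A holomorphic function with holomorphic generalized Schwarzian is locally injective. -/
lemma deriv_ne_zero_of_mem_HFam {k : ℕ} (hk : 1 ≤ k) {M : ℝ} {f : ℂ → ℂ} (hf : f ∈ HFam k M)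
    {a : ℂ} (ha : a ∈ unitDisk) : deriv f a ≠ 0 := by
  obtain ⟨⟨-, hnc, g, hg, -, hacc⟩, hfa⟩ := hf
  intro h0
  have hd : AnalyticAt ℂ (deriv f) a := (hfa a ha).deriv
  have hnz : ¬ ∀ᶠ z in 𝓝 a, deriv f z = 0 := by
    intro hev
    obtain ⟨ε, hε, hball⟩ := Metric.eventually_nhds_iff_ball.1 (hev.and
      (hfa a ha).eventually_analyticAt)
    refine hnc ⟨f a, a, ha, nhdsWithin_le_nhds (Metric.eventually_nhds_iff_ball.2
      ⟨ε, hε, fun w hw => ?_⟩)⟩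
    exact isOpen_ball.is_const_of_deriv_eq_zero (convex_ball a ε).isPreconnected
      (fun z hz => (hball z hz).2.differentiableAt.differentiableWithinAt)
      (fun z hz => (hball z hz).1) hw (mem_ball_self hε)
  obtain ⟨p, q, hq, hqa, hpq⟩ := hd.exists_eventuallyEq_pow_smul_nonzero_iff.2 hnz
  have hp : 1 ≤ p := by
    by_contra hlt
    obtain rfl : p = 0 := by omega
    exact hqa (by simpa [h0] using hpq.self_of_nhds.symm)
  have hpole : ∀ᶠ z in 𝓝[≠] a, ldd f z = (p + (z - a) * (deriv q z / q z)) / (z - a) := by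
    rw [eventually_nhdsWithin_iff]
    filter_upwards [hpq.eventually_nhds, hq.eventually_analyticAt,
      hq.continuousAt.eventually_ne hqa] with z hz1 hz2 hz3 hz4
    have hza : z - a ≠ 0 := sub_ne_zero.2 hz4
    have hder : HasDerivAt (fun z => (z - a) ^ p • q z) _ z :=
      (((hasDerivAt_id z).sub_const a).fun_pow p).fun_smul hz2.differentiableAt.hasDerivAt
    obtain ⟨s, rfl⟩ : ∃ s, p = s + 1 := ⟨p - 1, by omega⟩
    simp only [ldd]
    rw [EventuallyEq.deriv_eq hz1, hder.deriv, hz1.self_of_nhds]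
    simp only [id, smul_eq_mul, Nat.add_sub_cancel]
    push_cast
    field_simp
    ring
  have hG : AnalyticAt ℂ (fun z => p + (z - a) * (deriv q z / q z)) a := by
    have := hq.deriv.div hq hqa
    fun_prop
  obtain ⟨H, hH, hHa, hev⟩ := exists_SRec_eq_div_pow (n := k) hp hG (by simp) hpole (k - 1)
  have heq : ∀ᶠ z in 𝓝[≠] a, H z = (z - a) ^ k * g z := by
    filter_upwards [hev, eventually_eq_of_noAccIn isOpen_ball hacc ha, self_mem_nhdsWithin]
      with z hz1 hz2 hz3
    have hza : z - a ≠ 0 := sub_ne_zero.2 hz3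
    rw [Nat.sub_add_cancel hk] at hz1
    have hz4 : H z / (z - a) ^ k = g z := hz1.symm.trans hz2
    rw [← hz4]
    field_simp
  have hga := hg a ha
  have hlim : AnalyticAt ℂ (fun z => (z - a) ^ k * g z) a := by fun_prop
  have h2 := (hH.frequently_eq_iff_eventually_eq hlim).1 heq.frequently
  have h3 := h2.self_of_nhds
  rw [sub_self, zero_pow (by omega), zero_mul] at h3
  exact hHa h3

lemma ldd_analyticOnNhd_of_mem_HFam {k : ℕ} (hk : 1 ≤ k) {M : ℝ} {f : ℂ → ℂ}
    (hf : f ∈ HFam k M) : AnalyticOnNhd ℂ (ldd f) unitDisk :=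
  hf.2.deriv.deriv.div hf.2.deriv fun _ hz => deriv_ne_zero_of_mem_HFam hk hf hz

lemma norm_SRec_le_of_mem_HFam {k : ℕ} (hk : 1 ≤ k) {M : ℝ} {f : ℂ → ℂ} (hf : f ∈ HFam k M)
    {z : ℂ} (hz : z ∈ unitDisk) : ‖SRec k f (k - 1) z‖ ≤ M := by
  obtain ⟨g, hg, hgM, hacc⟩ := hf.1.2.2
  have hS := SRec_analyticOnNhd (n := k) (ldd_analyticOnNhd_of_mem_HFam hk hf) (k - 1) z hz
  have hev : ∀ᶠ w in 𝓝[≠] z, SRec k f (k - 1) w = g w :=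
    eventually_eq_of_noAccIn isOpen_ball hacc hz
  rw [((hS.frequently_eq_iff_eventually_eq (hg z hz)).1 hev.frequently).self_of_nhds]
  exact hgM z hz

/-- For every `k ∈ ℕ` and `M ∈ ℝ`, the family `H^{f''/f'}_{k,M}` is locally
uniformly bounded on the unit disk. -/
theorem HFam_logderiv_locUnifBdd (k : ℕ) (hk : 1 ≤ k) (M : ℝ) :
    LocUnifBddOn {g | ∃ f ∈ HFam k M, g = ldd f} unitDisk := by
  intro x hx
  have hx1 : ‖x‖ < 1 := by simpa [unitDisk] using hx
  have hball : ball x (1 - ‖x‖) ⊆ unitDisk :=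
    ball_subset_ball' (by simp)
  obtain ⟨C, hC⟩ := exists_bound_deriv_of_norm_iteratedDeriv_exp_le hk (K := |M| + 1)
    (R := 1 - ‖x‖) (by linarith [abs_nonneg M]) (by linarith) (by linarith [norm_nonneg x])
  have hk0 : (k : ℂ) ≠ 0 := by exact_mod_cast (by omega : k ≠ 0)
  refine ⟨ball x ((1 - ‖x‖) / 8), mem_nhdsWithin_of_mem_nhds (ball_mem_nhds x (by linarith)),
    k * C, ?_⟩
  rintro _ ⟨f, hf, rfl⟩ z hz
  have hP := (ldd_analyticOnNhd_of_mem_HFam hk hf).mono hball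
  obtain ⟨h, hh⟩ := (hP.differentiableOn.const_mul (-(1 / (k : ℂ)))).isExactOn_ball
  have hder := hC x h (fun w hw => (hh w hw).differentiableAt.differentiableWithinAt) ?_ z hz
  · rw [(hh z (ball_subset_ball (by linarith) hz)).deriv, norm_mul, norm_neg, norm_div, norm_one,
      Complex.norm_natCast] at hder
    have hkr : (0 : ℝ) < k := by exact_mod_cast hk
    rw [one_div, inv_mul_le_iff₀ hkr] at hder
    exact hder
  · intro w hw
    have h1 := iteratedDeriv_exp_eq_SRec isOpen_ball hP hh (k - 1) w hw
    rw [Nat.sub_add_cancel hk] at h1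
    rw [h1, norm_mul, norm_mul, norm_neg, norm_div, norm_one, Complex.norm_natCast]
    have hSM := norm_SRec_le_of_mem_HFam hk hf (hball hw)
    have hkr : (1 : ℝ) ≤ k := by exact_mod_cast hk
    gcongr
    calc 1 / (k : ℝ) * ‖SRec k f (k - 1) w‖ ≤ 1 * M := by
          gcongr
          exact (div_le_one (by linarith)).2 hkr
      _ ≤ |M| + 1 := by linarith [le_abs_self M]
end
end

section
/- For every k ∈ ℕ and every M ∈ ℝ, the family H'_{k,M} = { f' : f ∈ H_{k,M} } is normal on the unit disk 𝔻 (with respect to the spherical metric). -/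
open Complex Filter Set Metric Topology

noncomputable section

/-- Near every point of the disk, a member of `M_{k,M}` has `S_k` bounded by `M`. -/
theorem MFam.eventually_norm_Sk_le {k : ℕ} {M : ℝ} {f : ℂ → ℂ} (hf : f ∈ MFam k M) {z : ℂ}
    (hz : z ∈ unitDisk) : ∀ᶠ w in 𝓝[≠] z, ‖Sk k f w‖ ≤ M := by
  obtain ⟨-, -, g, -, hgM, hE⟩ := hf
  have h1 := hE z hz
  rw [accPt_iff_frequently_nhdsNE, not_frequently] at h1
  have h2 : ∀ᶠ w in 𝓝[≠] z, w ∈ unitDisk :=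
    nhdsWithin_le_nhds (isOpen_ball.mem_nhds hz)
  filter_upwards [h1, h2] with w hw hwD
  have : Sk k f w = g w := by
    by_contra hne
    exact hw ⟨hwD, hne⟩
  rw [this]
  exact hgM w hwD

/-- The derivative of a non-constant holomorphic function does not vanish identically
near any point. -/
theorem NonConstOn.not_eventually_deriv_eq_zero {f : ℂ → ℂ} (hn : NonConstOn f unitDisk)
    (hf : AnalyticOnNhd ℂ f unitDisk) {z : ℂ} (hz : z ∈ unitDisk) :
    ¬ ∀ᶠ w in 𝓝 z, deriv f w = 0 := by
  intro h
  obtain ⟨r, hr, hball⟩ := Metric.eventually_nhds_iff_ball.1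
    (h.and (isOpen_ball.mem_nhds hz : ∀ᶠ w in 𝓝 z, w ∈ unitDisk))
  refine hn ⟨f z, z, hz, nhdsWithin_le_nhds ?_⟩
  filter_upwards [ball_mem_nhds z hr] with w hw
  exact isOpen_ball.is_const_of_deriv_eq_zero (convex_ball z r).isPreconnected
    (fun x hx => (hf x (hball x hx).2).differentiableAt.differentiableWithinAt)
    (fun x hx => (hball x hx).1) hw (mem_ball_self hr)

/-- At a zero `z₀` of `f'`, the function `S_{m+2,n}(f)` has a pole of order `m + 1`. -/
theorem exists_analyticAt_pow_mul_SRec (n : ℕ) {f : ℂ → ℂ} {z₀ : ℂ}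
    (hf : AnalyticAt ℂ (deriv f) z₀) (h0 : deriv f z₀ = 0)
    (hne : ¬ ∀ᶠ w in 𝓝 z₀, deriv f w = 0) (m : ℕ) :
    ∃ A : ℂ → ℂ, AnalyticAt ℂ A z₀ ∧ A z₀ ≠ 0 ∧
      ∀ᶠ w in 𝓝[≠] z₀, (w - z₀) ^ (m + 1) * SRec n f m w = A w := by
  obtain ⟨d, q, hq, hq0, hpq⟩ := hf.exists_eventuallyEq_pow_smul_nonzero_iff.2 hne
  have hd : d ≠ 0 := by
    rintro rfl
    have := hpq.self_of_nhds
    simp [h0] at this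
    exact hq0 this.symm
  set B : ℂ → ℂ := fun w => d + (w - z₀) * (deriv q w / q w) with hB
  have hBa : AnalyticAt ℂ B z₀ := by
    have := hq.deriv
    rw [hB]
    fun_prop (disch := assumption)
  have hB0 : B z₀ = d := by simp [hB]
  have hldd : ∀ᶠ w in 𝓝[≠] z₀, (w - z₀) * ldd f w = B w := by
    have e1 := nhdsWithin_le_nhds (s := {z₀}ᶜ) hpq.eventually_nhds
    have e2 := nhdsWithin_le_nhds (s := {z₀}ᶜ) (hq.continuousAt.eventually_ne hq0)
    have e3 := nhdsWithin_le_nhds (s := {z₀}ᶜ) hq.eventually_analyticAt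
    filter_upwards [e1, e2, e3, self_mem_nhdsWithin] with w h1 h2 h3 h4
    have h5 : w - z₀ ≠ 0 := sub_ne_zero.2 h4
    have hD : deriv (deriv f) w
        = (d * (w - z₀) ^ (d - 1)) * q w + (w - z₀) ^ d * deriv q w := by
      rw [EventuallyEq.deriv_eq h1]
      have hp : HasDerivAt (fun w => (w - z₀) ^ d) (d * (w - z₀) ^ (d - 1)) w := by
        simpa using ((hasDerivAt_id w).sub_const z₀).fun_pow d
      simpa using (hp.fun_mul h3.differentiableAt.hasDerivAt).deriv
    have h6 : (w - z₀) ^ d = (w - z₀) ^ (d - 1) * (w - z₀) := by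
      rw [← pow_succ, Nat.sub_add_cancel (Nat.pos_of_ne_zero hd)]
    rw [ldd, hD, h1.self_of_nhds, hB, smul_eq_mul, h6]
    field_simp
  induction m with
  | zero =>
    refine ⟨B, hBa, by simpa [hB0] using hd, ?_⟩
    simpa [SRec] using hldd
  | succ m ih =>
    obtain ⟨A, hA, hA0, hAe⟩ := ih
    refine ⟨fun w => (w - z₀) * deriv A w - (m + 1) * A w - (1 / (n : ℂ)) * B w * A w,
      ?_, ?_, ?_⟩
    · have := hA.deriv
      fun_prop
    · have hpos : -((m : ℂ) + 1) - (1 / (n : ℂ)) * d ≠ 0 := by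
        have : -((m : ℂ) + 1) - (1 / (n : ℂ)) * d = ((-((m : ℝ) + 1 + 1 / n * d) : ℝ) : ℂ) := by
          push_cast; ring
        rw [this, ofReal_ne_zero]
        have : (0 : ℝ) < (m : ℝ) + 1 + 1 / n * d := by positivity
        linarith
      simp only [sub_self, zero_mul, zero_sub, hB0]
      have := mul_ne_zero hpos hA0
      convert this using 1
      ring
    · have e1 := eventually_eventually_nhdsWithin.2 hAe
      have e3 := nhdsWithin_le_nhds (s := {z₀}ᶜ) hA.eventually_analyticAt
      filter_upwards [e1, hldd, e3, self_mem_nhdsWithin] with w h1 h2 h3 h4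
      have h5 : w - z₀ ≠ 0 := sub_ne_zero.2 h4
      rw [isOpen_compl_singleton.nhdsWithin_eq h4] at h1
      have hS : SRec n f m =ᶠ[𝓝 w] fun w => A w / (w - z₀) ^ (m + 1) := by
        filter_upwards [h1, isOpen_compl_singleton.mem_nhds h4] with x hx hxne
        rw [← hx, mul_div_cancel_left₀]
        exact pow_ne_zero _ (sub_ne_zero.2 hxne)
      have hp : HasDerivAt (fun w => (w - z₀) ^ (m + 1)) ((m + 1) * (w - z₀) ^ m) w := by
        simpa using ((hasDerivAt_id w).sub_const z₀).fun_pow (m + 1)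
      have hD := (h3.differentiableAt.hasDerivAt.div hp (pow_ne_zero _ h5)).deriv
      have hD' : deriv (SRec n f m) w = _ := hS.deriv_eq.trans hD
      have h2' : ldd f w = B w / (w - z₀) := by rw [← h2, mul_div_cancel_left₀ _ h5]
      simp only [SRec]
      rw [hD', hS.self_of_nhds, h2']
      field_simp
      ring

/-- The derivative of a function in `H_{k,M}` has no zeros. -/
theorem HFam.deriv_ne_zero {k : ℕ} {M : ℝ} {f : ℂ → ℂ} (hf : f ∈ HFam k M)
    {z : ℂ} (hz : z ∈ unitDisk) : deriv f z ≠ 0 := by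
  intro h0
  obtain ⟨A, hA, hA0, hAe⟩ := exists_analyticAt_pow_mul_SRec k (hf.2 z hz).deriv h0
    (hf.1.2.1.not_eventually_deriv_eq_zero hf.2 hz) (k - 1)
  have hb := MFam.eventually_norm_Sk_le hf.1 hz
  have hlim : Tendsto (fun w => ‖w - z‖ ^ (k - 1 + 1) * M) (𝓝[≠] z) (𝓝 0) := by
    have : Continuous fun w : ℂ => ‖w - z‖ ^ (k - 1 + 1) * M := by fun_prop
    simpa using (this.tendsto z).mono_left nhdsWithin_le_nhds
  have hA1 : Tendsto (fun w => ‖A w‖) (𝓝[≠] z) (𝓝 ‖A z‖) :=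
    (hA.continuousAt.norm.tendsto).mono_left nhdsWithin_le_nhds
  have hle : ‖A z‖ ≤ 0 := by
    refine le_of_tendsto_of_tendsto hA1 hlim ?_
    filter_upwards [hAe, hb] with w h1 h2
    rw [← h1, norm_mul, norm_pow]
    gcongr
    exact h2
  exact hA0 (norm_le_zero_iff.1 hle)

theorem SRec_analyticAt (n : ℕ) {f : ℂ → ℂ} {z : ℂ} (hf : AnalyticAt ℂ (deriv f) z)
    (h0 : deriv f z ≠ 0) (m : ℕ) : AnalyticAt ℂ (SRec n f m) z := by
  have hl : AnalyticAt ℂ (ldd f) z := hf.deriv.div hf h0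
  induction m with
  | zero => exact hl
  | succ m ih => exact ih.deriv.sub ((analyticAt_const.mul hl).mul ih)

theorem HFam.norm_Sk_le {k : ℕ} {M : ℝ} {f : ℂ → ℂ} (hf : f ∈ HFam k M)
    {z : ℂ} (hz : z ∈ unitDisk) : ‖Sk k f z‖ ≤ M := by
  have hc : ContinuousAt (Sk k f) z :=
    (SRec_analyticAt k (hf.2 z hz).deriv (HFam.deriv_ne_zero hf hz) _).continuousAt
  exact le_of_tendsto (hc.norm.tendsto.mono_left nhdsWithin_le_nhds)
    (MFam.eventually_norm_Sk_le hf.1 hz)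

/-- Iterated derivatives of holomorphic functions are holomorphic. -/
theorem iteratedDeriv_differentiableOn_unitDisk {h : ℂ → ℂ} (hh : DifferentiableOn ℂ h unitDisk)
    (m : ℕ) : DifferentiableOn ℂ (iteratedDeriv m h) unitDisk := by
  induction m with
  | zero => simpa using hh
  | succ m ih =>
    rw [iteratedDeriv_succ]
    exact ih.deriv isOpen_ball

/-- If `h' = -(1/n) (f''/f') h`, then `h S_{m+2,n}(f) = -n h^{(m+1)}`. -/
theorem iteratedDeriv_eq_SRec {n : ℕ} {f h : ℂ → ℂ}
    (hf : ∀ m, DifferentiableOn ℂ (SRec n f m) unitDisk)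
    (hh : ∀ z ∈ unitDisk, HasDerivAt h (-(1 / (n : ℂ)) * ldd f z * h z) z) (m : ℕ) :
    ∀ z ∈ unitDisk, iteratedDeriv (m + 1) h z = -(1 / (n : ℂ)) * SRec n f m z * h z := by
  induction m with
  | zero =>
    intro z hz
    simpa [SRec] using (hh z hz).deriv
  | succ m ih =>
    intro z hz
    rw [iteratedDeriv_succ]
    have e : iteratedDeriv (m + 1) h =ᶠ[𝓝 z] fun w => -(1 / (n : ℂ)) * SRec n f m w * h w := by
      filter_upwards [isOpen_ball.mem_nhds hz] with w hw using ih w hw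
    have hS : HasDerivAt (SRec n f m) (deriv (SRec n f m) z) z :=
      ((hf m).differentiableAt (isOpen_ball.mem_nhds hz)).hasDerivAt
    rw [e.deriv_eq, ((hS.const_mul (-(1 / (n : ℂ)))).fun_mul (hh z hz)).deriv]
    simp only [SRec]
    ring

/-- For `f ∈ H_{k,M}`, one can write `f' = a h^{-k}` with `h` zero-free, normalized at the origin
and satisfying a linear differential inequality of order `k`. -/
theorem HFam.exists_root {k : ℕ} (hk : 1 ≤ k) {M : ℝ} {f : ℂ → ℂ} (hf : f ∈ HFam k M) :
    ∃ (a : ℂ) (h : ℂ → ℂ), DifferentiableOn ℂ h unitDisk ∧ (∀ z ∈ unitDisk, h z ≠ 0) ∧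
      (∀ z ∈ unitDisk, deriv f z = a * (h z ^ k)⁻¹) ∧
      (∑ j ∈ Finset.range k, ‖iteratedDeriv j h 0‖ = 1) ∧
      ∀ z ∈ unitDisk, ‖iteratedDeriv k h z‖ ≤ M * ‖h z‖ := by
  have hp0 : ∀ z ∈ unitDisk, deriv f z ≠ 0 := fun z hz => HFam.deriv_ne_zero hf hz
  have hSd : ∀ m, DifferentiableOn ℂ (SRec k f m) unitDisk := fun m z hz =>
    (SRec_analyticAt k (hf.2 z hz).deriv (hp0 z hz) m).differentiableAt.differentiableWithinAt
  have hkC : (k : ℂ) ≠ 0 := by exact_mod_cast (by omega : k ≠ 0)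
  have h0D : (0 : ℂ) ∈ unitDisk := mem_ball_self one_pos
  have hld : DifferentiableOn ℂ (fun z => -(1 / (k : ℂ)) * ldd f z) unitDisk :=
    (hSd 0).const_mul _
  obtain ⟨L, hL⟩ := hld.isExactOn_ball
  set h₀ : ℂ → ℂ := fun z => cexp (L z) with hh₀
  have hh : ∀ z ∈ unitDisk, HasDerivAt h₀ (-(1 / (k : ℂ)) * ldd f z * h₀ z) z := fun z hz => by
    simpa [hh₀, mul_comm] using (hL z hz).cexp
  have hne : ∀ z, h₀ z ≠ 0 := fun z => exp_ne_zero _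
  have hd : DifferentiableOn ℂ h₀ unitDisk := fun z hz =>
    (hh z hz).differentiableAt.differentiableWithinAt
  have hconst : ∀ z ∈ unitDisk, deriv f z * h₀ z ^ k = deriv f 0 * h₀ 0 ^ k := by
    intro z hz
    have hder : ∀ w ∈ unitDisk, HasDerivAt (fun w => deriv f w * h₀ w ^ k) 0 w := by
      intro w hw
      have h1 := ((hf.2 w hw).deriv.differentiableAt.hasDerivAt).fun_mul ((hh w hw).fun_pow k)
      refine h1.congr_deriv ?_
      have h2 : h₀ w ^ k = h₀ w ^ (k - 1) * h₀ w := by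
        rw [← pow_succ, Nat.sub_add_cancel hk]
      have := hp0 w hw
      simp only [ldd, h2]
      field_simp
      ring
    exact isOpen_ball.is_const_of_deriv_eq_zero (convex_ball (0 : ℂ) 1).isPreconnected
      (fun w hw => (hder w hw).differentiableAt.differentiableWithinAt)
      (fun w hw => (hder w hw).deriv) hz h0D
  set N : ℝ := ∑ j ∈ Finset.range k, ‖iteratedDeriv j h₀ 0‖ with hN
  have hNpos : 0 < N := by
    have h1 : ‖iteratedDeriv 0 h₀ 0‖ ≤ N :=
      Finset.single_le_sum (f := fun j => ‖iteratedDeriv j h₀ 0‖)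
        (fun j _ => norm_nonneg _) (Finset.mem_range.2 (by omega))
    rw [iteratedDeriv_zero] at h1
    exact (norm_pos_iff.2 (hne 0)).trans_le h1
  have hNC : (N : ℂ) ≠ 0 := ofReal_ne_zero.2 hNpos.ne'
  have hit : ∀ j z, iteratedDeriv j (fun w => (N : ℂ)⁻¹ * h₀ w) z
      = (N : ℂ)⁻¹ * iteratedDeriv j h₀ z := fun j z => iteratedDeriv_const_mul_field _ _
  refine ⟨deriv f 0 * h₀ 0 ^ k * (N : ℂ)⁻¹ ^ k, fun w => (N : ℂ)⁻¹ * h₀ w, hd.const_mul _,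
    fun z _ => mul_ne_zero (inv_ne_zero hNC) (hne z), ?_, ?_, ?_⟩
  · intro z hz
    have := pow_ne_zero k (hne z)
    rw [← hconst z hz, mul_pow]
    field_simp
  · simp only [hit, norm_mul]
    rw [← Finset.mul_sum, ← hN, norm_inv, norm_real, Real.norm_of_nonneg hNpos.le,
      inv_mul_cancel₀ hNpos.ne']
  · intro z hz
    obtain ⟨m, rfl⟩ : ∃ m, k = m + 1 := ⟨k - 1, by omega⟩
    have hS : ‖SRec (m + 1) f m z‖ ≤ M := HFam.norm_Sk_le hf hz
    have h1 : ‖-(1 / ((m + 1 : ℕ) : ℂ))‖ ≤ 1 := by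
      rw [norm_neg, norm_div, norm_one, Complex.norm_natCast]
      exact div_le_one_of_le₀ (by exact_mod_cast hk) (by positivity)
    rw [hit, iteratedDeriv_eq_SRec hSd hh m z hz, norm_mul, norm_mul, norm_mul, norm_mul]
    calc ‖(N : ℂ)⁻¹‖ * (‖-(1 / ((m + 1 : ℕ) : ℂ))‖ * ‖SRec (m + 1) f m z‖ * ‖h₀ z‖)
        ≤ ‖(N : ℂ)⁻¹‖ * (1 * M * ‖h₀ z‖) := by gcongr
      _ = M * (‖(N : ℂ)⁻¹‖ * ‖h₀ z‖) := by ring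

/-- Gronwall estimate for a linear differential inequality of order `k` on the disk. -/
theorem norm_le_exp_of_norm_iteratedDeriv_le {k : ℕ} (hk : 1 ≤ k) {K : ℝ} (hK : 1 ≤ K)
    {h : ℂ → ℂ} (hd : DifferentiableOn ℂ h unitDisk)
    (hb : ∀ z ∈ unitDisk, ‖iteratedDeriv k h z‖ ≤ K * ‖h z‖)
    (h0 : ∀ j < k, ‖iteratedDeriv j h 0‖ ≤ 1) {z : ℂ} (hz : z ∈ unitDisk) :
    ‖h z‖ ≤ Real.exp K := by
  have hz1 : ‖z‖ < 1 := by simpa [unitDisk] using hz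
  have hmem : ∀ t ∈ Icc (0 : ℝ) 1, (t : ℂ) * z ∈ unitDisk := by
    intro t ht
    simp only [unitDisk, mem_ball_zero_iff, norm_mul, norm_real, Real.norm_of_nonneg ht.1]
    nlinarith [ht.2, norm_nonneg z]
  let v : ℝ → Fin k → ℂ := fun t j => iteratedDeriv j h (t * z)
  let v' : ℝ → Fin k → ℂ := fun t j => iteratedDeriv (j + 1) h (t * z) * z
  have hv : ∀ t ∈ Icc (0 : ℝ) 1, HasDerivAt v (v' t) t := by
    intro t ht
    rw [hasDerivAt_pi]
    intro j
    have h1 : HasDerivAt (iteratedDeriv j h) (iteratedDeriv (j + 1) h (t * z)) (t * z) := by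
      rw [iteratedDeriv_succ]
      exact ((iteratedDeriv_differentiableOn_unitDisk hd j).differentiableAt
        (isOpen_ball.mem_nhds (hmem t ht))).hasDerivAt
    have h2 : HasDerivAt (fun s : ℝ => (s : ℂ) * z) z t := by
      simpa using (hasDerivAt_id t).ofReal_comp.mul_const z
    exact h1.comp t h2
  have hbound : ∀ t ∈ Ico (0 : ℝ) 1, ‖v' t‖ ≤ K * ‖v t‖ + 0 := by
    intro t ht
    have hvt : 0 ≤ ‖v t‖ := norm_nonneg _
    rw [add_zero, pi_norm_le_iff_of_nonneg (by positivity)]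
    intro j
    have h1 : ‖iteratedDeriv (j + 1) h (t * z)‖ ≤ K * ‖v t‖ := by
      rcases (Nat.succ_le_of_lt j.2).lt_or_eq with hj | hj
      · have : ‖iteratedDeriv (j + 1) h (t * z)‖ ≤ ‖v t‖ := norm_le_pi_norm (v t) ⟨j + 1, hj⟩
        nlinarith
      · have h2 : ‖h (t * z)‖ ≤ ‖v t‖ := by
          simpa [v] using norm_le_pi_norm (v t) ⟨0, by omega⟩
        have h3 := hb (t * z) (hmem t (Ico_subset_Icc_self ht))
        have h4 : (j : ℕ) + 1 = k := hj
        rw [h4]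
        exact h3.trans (by gcongr)
    calc ‖v' t j‖ = ‖iteratedDeriv (j + 1) h (t * z)‖ * ‖z‖ := norm_mul _ _
      _ ≤ ‖iteratedDeriv (j + 1) h (t * z)‖ * 1 := by gcongr
      _ ≤ K * ‖v t‖ := by rwa [mul_one]
  have hinit : ‖v 0‖ ≤ 1 := by
    rw [pi_norm_le_iff_of_nonneg zero_le_one]
    intro j
    simpa [v] using h0 j j.2
  have hG := norm_le_gronwallBound_of_norm_deriv_right_le
    (fun t ht => (hv t ht).continuousAt.continuousWithinAt)
    (fun t ht => (hv t (Ico_subset_Icc_self ht)).hasDerivWithinAt) hinit hbound 1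
    (right_mem_Icc.2 zero_le_one)
  rw [gronwallBound_ε0] at hG
  have h2 : ‖h z‖ ≤ ‖v 1‖ := by
    simpa [v] using norm_le_pi_norm (v 1) ⟨0, by omega⟩
  simpa using h2.trans hG

/-- Cauchy estimate for the Taylor coefficients at the origin of a bounded function. -/
theorem norm_iteratedDeriv_div_factorial_le {h : ℂ → ℂ} {C : ℝ}
    (hd : DifferentiableOn ℂ h unitDisk) (hC : ∀ z ∈ unitDisk, ‖h z‖ ≤ C) (j : ℕ) :
    ‖((j.factorial : ℂ))⁻¹ * iteratedDeriv j h 0‖ ≤ C := by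
  have hr : ∀ᶠ r : ℝ in 𝓝[<] 1, ‖((j.factorial : ℂ))⁻¹ * iteratedDeriv j h 0‖ ≤ C / r ^ j := by
    filter_upwards [Ioo_mem_nhdsLT (zero_lt_one (α := ℝ))] with r hr
    have hsub : closedBall (0 : ℂ) r ⊆ unitDisk := closedBall_subset_ball hr.2
    have h1 := Complex.norm_iteratedDeriv_le_of_forall_mem_sphere_norm_le j hr.1
      ((hd.mono hsub).diffContOnCl_ball Subset.rfl)
      (fun z hz => hC z (hsub (sphere_subset_closedBall hz)))
    rw [norm_mul, norm_inv, Complex.norm_natCast, inv_mul_le_iff₀ (by positivity), ← mul_div_assoc]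
    exact h1
  have hlim : Tendsto (fun r : ℝ => C / r ^ j) (𝓝[<] 1) (𝓝 C) := by
    have : ContinuousAt (fun r : ℝ => C / r ^ j) 1 := by fun_prop (disch := simp)
    simpa using this.tendsto.mono_left nhdsWithin_le_nhds
  exact ge_of_tendsto hlim hr

/-- Montel's theorem for uniformly bounded sequences on the unit disk. -/
theorem exists_subseq_tendstoLocallyUniformlyOn {h : ℕ → ℂ → ℂ} {C : ℝ}
    (hd : ∀ n, DifferentiableOn ℂ (h n) unitDisk) (hC : ∀ n, ∀ z ∈ unitDisk, ‖h n z‖ ≤ C) :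
    ∃ φ : ℕ → ℕ, StrictMono φ ∧ ∃ H : ℂ → ℂ,
      TendstoLocallyUniformlyOn (fun n => h (φ n)) H atTop unitDisk := by
  let c : ℕ → ℕ → ℂ := fun n j => ((j.factorial : ℂ))⁻¹ * iteratedDeriv j (h n) 0
  have hcC : ∀ n j, ‖c n j‖ ≤ C := fun n j =>
    norm_iteratedDeriv_div_factorial_le (hd n) (hC n) j
  have hK : IsCompact (Set.pi univ fun _ : ℕ => closedBall (0 : ℂ) C) :=
    isCompact_univ_pi fun _ => isCompact_closedBall _ _
  obtain ⟨b, hb, φ, hφ, hlim⟩ := hK.tendsto_subseq (x := c)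
    (fun n j _ => by simpa using hcC n j)
  have hbC : ∀ j, ‖b j‖ ≤ C := fun j => by simpa using hb j (mem_univ j)
  refine ⟨φ, hφ, fun z => ∑' j, b j * z ^ j, ?_⟩
  refine (tendstoLocallyUniformlyOn_iff_forall_isCompact isOpen_ball).2 ?_
  intro S hSD hS
  obtain ⟨r, hr0, hr1, hSr⟩ : ∃ r : ℝ, 0 ≤ r ∧ r < 1 ∧ ∀ z ∈ S, ‖z‖ ≤ r := by
    rcases S.eq_empty_or_nonempty with rfl | hne
    · exact ⟨0, le_rfl, one_pos, by simp⟩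
    · obtain ⟨w, hw, hmax⟩ := hS.exists_isMaxOn hne continuous_norm.continuousOn
      exact ⟨‖w‖, norm_nonneg _, by simpa [unitDisk] using hSD hw, fun z hz => hmax hz⟩
  have hgeo : Summable fun j : ℕ => (2 * C) * r ^ j :=
    (summable_geometric_of_lt_one hr0 hr1).mul_left _
  have hdiff : ∀ n j, ‖c n j - b j‖ ≤ 2 * C := fun n j =>
    (norm_sub_le _ _).trans (by linarith [hcC n j, hbC j])
  have hsum : Tendsto (fun n => ∑' j, ‖c (φ n) j - b j‖ * r ^ j) atTop (𝓝 0) := by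
    have := tendsto_tsum_of_dominated_convergence (𝓕 := atTop)
      (f := fun n j => ‖c (φ n) j - b j‖ * r ^ j) (g := fun _ => (0 : ℝ)) hgeo
      (fun j => by
        have h1 : Tendsto (fun n => c (φ n) j) atTop (𝓝 (b j)) := (tendsto_pi_nhds.1 hlim) j
        simpa using ((h1.sub_const (b j)).norm).mul_const (r ^ j))
      (Eventually.of_forall fun n j => by
        rw [Real.norm_of_nonneg (by positivity)]
        gcongr
        exact hdiff _ _)
    simpa using this
  rw [Metric.tendstoUniformlyOn_iff]
  intro ε hε
  filter_upwards [hsum.eventually (gt_mem_nhds hε)] with n hn z hz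
  have hzr := hSr z hz
  have hbs : Summable fun j => b j * z ^ j := by
    refine Summable.of_norm_bounded ((summable_geometric_of_lt_one hr0 hr1).mul_left C) fun j => ?_
    rw [norm_mul, norm_pow]
    have := (norm_nonneg _).trans (hbC j)
    gcongr
    exact hbC j
  have hT : HasSum (fun j => c (φ n) j * z ^ j) (h (φ n) z) := by
    refine (Complex.hasSum_taylorSeries_on_ball (hd (φ n)) (hSD hz)).congr_fun fun j => ?_
    simp only [c, smul_eq_mul, sub_zero]
    ring
  have hsub := hT.sub hbs.hasSum
  have hs2 : Summable fun j => ‖c (φ n) j - b j‖ * r ^ j := by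
    refine Summable.of_nonneg_of_le (fun j => by positivity) (fun j => ?_) hgeo
    gcongr
    exact hdiff _ _
  have hle : ‖h (φ n) z - ∑' j, b j * z ^ j‖ ≤ ∑' j, ‖c (φ n) j - b j‖ * r ^ j := by
    refine hsub.norm_le_of_bounded hs2.hasSum fun j => ?_
    rw [← sub_mul, norm_mul, norm_pow]
    gcongr
  rw [dist_comm, dist_eq_norm]
  exact hle.trans_lt hn

theorem tendsto_iteratedDeriv_of_tendstoLocallyUniformlyOn {h : ℕ → ℂ → ℂ} {H : ℂ → ℂ}
    (hd : ∀ n, DifferentiableOn ℂ (h n) unitDisk)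
    (hH : TendstoLocallyUniformlyOn h H atTop unitDisk) {z : ℂ} (hz : z ∈ unitDisk) (j : ℕ) :
    Tendsto (fun n => iteratedDeriv j (h n) z) atTop (𝓝 (iteratedDeriv j H z)) := by
  induction j generalizing h H with
  | zero => simpa using hH.tendsto_at hz
  | succ j ih =>
    simp only [iteratedDeriv_succ']
    exact ih (fun n => (hd n).deriv isOpen_ball)
      (hH.deriv (Eventually.of_forall hd) isOpen_ball)

/-- Hurwitz's theorem: a locally uniform limit of zero-free holomorphic functions on the disk
which does not vanish identically is zero-free. -/
theorem ne_zero_of_tendstoLocallyUniformlyOn {h : ℕ → ℂ → ℂ} {H : ℂ → ℂ}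
    (hd : ∀ n, DifferentiableOn ℂ (h n) unitDisk) (hne : ∀ n, ∀ z ∈ unitDisk, h n z ≠ 0)
    (hH : TendstoLocallyUniformlyOn h H atTop unitDisk)
    (hH0 : ¬ EqOn H 0 unitDisk) {z : ℂ} (hz : z ∈ unitDisk) : H z ≠ 0 := by
  intro hHz
  have hHd : DifferentiableOn ℂ H unitDisk :=
    hH.differentiableOn (Eventually.of_forall hd) isOpen_ball
  have hHa : AnalyticOnNhd ℂ H unitDisk := hHd.analyticOnNhd isOpen_ball
  have hev : ∀ᶠ w in 𝓝[≠] z, H w ≠ 0 := by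
    rcases (hHa z hz).eventually_eq_zero_or_eventually_ne_zero with h1 | h1
    · exact absurd (hHa.eqOn_zero_of_preconnected_of_eventuallyEq_zero
        (convex_ball (0 : ℂ) 1).isPreconnected hz h1) hH0
    · exact h1
  rw [eventually_nhdsWithin_iff] at hev
  obtain ⟨R, hR, hball⟩ := Metric.eventually_nhds_iff_ball.1
    (hev.and (isOpen_ball.mem_nhds hz : ∀ᶠ w in 𝓝 z, w ∈ unitDisk))
  set r := R / 2 with hr
  have hr0 : 0 < r := by positivity
  have hsub : closedBall z r ⊆ ball z R := closedBall_subset_ball (by linarith)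
  have hsubD : closedBall z r ⊆ unitDisk := fun w hw => (hball w (hsub hw)).2
  have hsphne : (sphere z r).Nonempty := NormedSpace.sphere_nonempty.2 hr0.le
  obtain ⟨w₀, hw₀, hmin⟩ := (isCompact_sphere z r).exists_isMinOn hsphne
    ((hHd.continuousOn.mono (sphere_subset_closedBall.trans hsubD)).norm)
  have hδ : 0 < ‖H w₀‖ := by
    refine norm_pos_iff.2 ((hball w₀ (hsub (sphere_subset_closedBall hw₀))).1 ?_)
    exact ne_of_mem_sphere hw₀ hr0.ne'
  set δ := ‖H w₀‖ with hδdef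
  have hunif := (tendstoLocallyUniformlyOn_iff_forall_isCompact isOpen_ball).1 hH
    (sphere z r) (sphere_subset_closedBall.trans hsubD) (isCompact_sphere z r)
  rw [Metric.tendstoUniformlyOn_iff] at hunif
  have hlower : ∀ᶠ n in atTop, δ / 2 ≤ ‖h n z‖ := by
    filter_upwards [hunif (δ / 2) (by positivity)] with n hn
    have hinvd : DifferentiableOn ℂ (fun w => (h n w)⁻¹) (closedBall z r) :=
      ((hd n).mono hsubD).inv fun w hw => hne n w (hsubD hw)
    have hle : ‖(h n z)⁻¹‖ ≤ (δ / 2)⁻¹ := by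
      refine Complex.norm_le_of_forall_mem_frontier_norm_le (U := ball z r) isBounded_ball
        (hinvd.diffContOnCl_ball Subset.rfl) ?_ (subset_closure (mem_ball_self hr0))
      intro w hw
      rw [frontier_ball z hr0.ne'] at hw
      have h1 : δ ≤ ‖H w‖ := hmin hw
      have h2 := hn w hw
      rw [dist_eq_norm] at h2
      have h3 := norm_sub_norm_le (H w) (h n w)
      rw [norm_inv]
      gcongr
      linarith
    rw [norm_inv] at hle
    exact (inv_le_inv₀ (norm_pos_iff.2 (hne n z hz)) (by positivity)).1 hle
  have hlim : Tendsto (fun n => ‖h n z‖) atTop (𝓝 0) := by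
    simpa [hHz] using (hH.tendsto_at hz).norm
  linarith [ge_of_tendsto hlim hlower]

theorem sphDist_coe_coe_le (z w : ℂ) : sphDist (z : OnePoint ℂ) (w : OnePoint ℂ) ≤ ‖z - w‖ := by
  have h1 : ∀ u : ℂ, 1 ≤ Real.sqrt (1 + ‖u‖ ^ 2) := fun u =>
    Real.one_le_sqrt.2 (by nlinarith [norm_nonneg u])
  exact div_le_self (norm_nonneg _) (one_le_mul_of_one_le_of_one_le (h1 z) (h1 w))

theorem sphDist_coe_infty_le {z : ℂ} (hz : z ≠ 0) :
    sphDist (z : OnePoint ℂ) OnePoint.infty ≤ ‖z‖⁻¹ := by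
  change 1 / Real.sqrt (1 + ‖z‖ ^ 2) ≤ ‖z‖⁻¹
  rw [one_div]
  have : 0 < ‖z‖ := norm_pos_iff.2 hz
  gcongr
  exact Real.le_sqrt_of_sq_le (by linarith)

/-- Spherical locally uniform convergence from joint smallness of the spherical distance. -/
theorem TendstoLocUnifSph.of_eventually_prod {F : ℕ → ℂ → ℂ} {g : ℂ → OnePoint ℂ} {U : Set ℂ}
    (h : ∀ x ∈ U, ∀ ε > (0 : ℝ), ∀ᶠ y : ℕ × ℂ in atTop ×ˢ 𝓝[U] x,
      sphDist (F y.1 y.2 : OnePoint ℂ) (g y.2) < ε) : TendstoLocUnifSph F g U := by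
  intro ε hε x hx
  obtain ⟨p, hp, q, hq, hpq⟩ := eventually_prod_iff.1 (h x hx ε hε)
  exact ⟨{y | q y}, hq, hp.mono fun n hn y hy => hpq hn hy⟩

/-- For every `k ∈ ℕ` and `M ∈ ℝ`, the family `H'_{k,M} = {f' : f ∈ H_{k,M}}`
is normal on the unit disk. -/
theorem HFam_deriv_normal (k : ℕ) (hk : 1 ≤ k) (M : ℝ) :
    NormalOn {g | ∃ f ∈ HFam k M, g = deriv f} unitDisk := by
  intro F hF
  choose f hf hFf using hF
  choose a h hd hne hfa hN hb using fun n => HFam.exists_root hk (hf n)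
  have hC : ∀ n, ∀ z ∈ unitDisk, ‖h n z‖ ≤ Real.exp (max 1 M) := fun n z hz =>
    norm_le_exp_of_norm_iteratedDeriv_le hk (le_max_left 1 M) (hd n)
      (fun w hw => (hb n w hw).trans (by gcongr; exact le_max_right _ _))
      (fun j hj => hN n ▸ Finset.single_le_sum (f := fun j => ‖iteratedDeriv j (h n) 0‖)
        (fun _ _ => norm_nonneg _) (Finset.mem_range.2 hj)) hz
  obtain ⟨φ, hφ, H, hH⟩ := exists_subseq_tendstoLocallyUniformlyOn hd hC
  have hH0 : ¬ EqOn H 0 unitDisk := by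
    intro h0
    have hz0 : (0 : ℂ) ∈ unitDisk := mem_ball_self one_pos
    have h1 := tendsto_finsetSum (Finset.range k) fun j _ =>
      (tendsto_iteratedDeriv_of_tendstoLocallyUniformlyOn (fun n => hd (φ n)) hH hz0 j).norm
    simp only [hN] at h1
    have h2 : H =ᶠ[𝓝 0] fun _ => 0 := by
      filter_upwards [isOpen_ball.mem_nhds hz0] with w hw using h0 hw
    have h3 := tendsto_nhds_unique h1 tendsto_const_nhds
    simp [h2.iteratedDeriv_eq] at h3
  have hHne : ∀ z ∈ unitDisk, H z ≠ 0 := fun z hz =>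
    ne_zero_of_tendstoLocallyUniformlyOn (fun n => hd (φ n)) (fun n => hne (φ n)) hH hH0 hz
  have hHc : ContinuousOn H unitDisk :=
    (hH.differentiableOn (Eventually.of_forall fun n => hd (φ n)) isOpen_ball).continuousOn
  have hmem : ∀ x, ∀ᶠ y : ℕ × ℂ in atTop ×ˢ 𝓝[unitDisk] x, y.2 ∈ unitDisk := fun x =>
    tendsto_snd.eventually self_mem_nhdsWithin
  by_cases hbd : ∃ R : ℝ, ∃ᶠ n in atTop, a (φ n) ∈ closedBall 0 R
  · obtain ⟨R, hR⟩ := hbd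
    obtain ⟨α, -, ψ, hψ, hα⟩ := tendsto_subseq_of_frequently_bounded isBounded_closedBall hR
    refine ⟨φ ∘ ψ, hφ.comp hψ, fun z => ((α * (H z ^ k)⁻¹ : ℂ) : OnePoint ℂ), ?_⟩
    refine TendstoLocUnifSph.of_eventually_prod fun x hx ε hε => ?_
    have hlim2 : Tendsto (fun y : ℕ × ℂ => H y.2) (atTop ×ˢ 𝓝[unitDisk] x) (𝓝 (H x)) :=
      (hHc x hx).tendsto.comp tendsto_snd
    have hlim1 : Tendsto (fun y : ℕ × ℂ => h (φ (ψ y.1)) y.2) (atTop ×ˢ 𝓝[unitDisk] x)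
        (𝓝 (H x)) := by
      have h1 := (tendstoLocallyUniformlyOn_iff_forall_tendsto.1 hH) x hx
      have h2 : Tendsto (fun y : ℕ × ℂ => (ψ y.1, y.2)) (atTop ×ˢ 𝓝[unitDisk] x)
          (atTop ×ˢ 𝓝[unitDisk] x) :=
        (hψ.tendsto_atTop.comp tendsto_fst).prodMk tendsto_snd
      have h3 := h1.comp h2
      exact hlim2.congr_uniformity h3
    have hα' : Tendsto (fun y : ℕ × ℂ => a (φ (ψ y.1))) (atTop ×ˢ 𝓝[unitDisk] x) (𝓝 α) :=
      hα.comp tendsto_fst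
    have hxk : H x ^ k ≠ 0 := pow_ne_zero _ (hHne x hx)
    have hl := ((hα'.mul ((hlim1.pow k).inv₀ hxk)).sub
      (((hlim2.pow k).inv₀ hxk).const_mul α)).norm
    rw [sub_self, norm_zero] at hl
    filter_upwards [hl.eventually (gt_mem_nhds hε), hmem x] with y hy hyD
    refine (sphDist_coe_coe_le _ _).trans_lt ?_
    simpa only [Function.comp_apply, hFf, hfa _ _ hyD] using hy
  · rw [not_exists] at hbd
    refine ⟨φ, hφ, fun _ => OnePoint.infty, ?_⟩
    refine TendstoLocUnifSph.of_eventually_prod fun x hx ε hε => ?_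
    set B := Real.exp (max 1 M) ^ k with hB
    have hBpos : 0 < B := by positivity
    have hev : ∀ᶠ y : ℕ × ℂ in atTop ×ˢ 𝓝[unitDisk] x, a (φ y.1) ∉ closedBall 0 (B / ε) :=
      tendsto_fst.eventually (not_frequently.1 (hbd (B / ε)))
    filter_upwards [hev, hmem x] with y hy hyD
    have hy' : B / ε < ‖a (φ y.1)‖ := by simpa using hy
    have hapos : 0 < ‖a (φ y.1)‖ := (by positivity : 0 < B / ε).trans hy'
    have heq : F (φ y.1) y.2 = a (φ y.1) * (h (φ y.1) y.2 ^ k)⁻¹ := by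
      rw [hFf, hfa _ _ hyD]
    have hhne := hne (φ y.1) y.2 hyD
    have hne0 : F (φ y.1) y.2 ≠ 0 := by
      rw [heq]
      exact mul_ne_zero (norm_pos_iff.1 hapos) (inv_ne_zero (pow_ne_zero _ hhne))
    refine (sphDist_coe_infty_le hne0).trans_lt ?_
    rw [heq, ← norm_inv, mul_inv, inv_inv, norm_mul, norm_inv, norm_pow]
    calc ‖a (φ y.1)‖⁻¹ * ‖h (φ y.1) y.2‖ ^ k ≤ ‖a (φ y.1)‖⁻¹ * B := by
          gcongr
          exact pow_le_pow_left₀ (norm_nonneg _) (hC _ _ hyD) k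
      _ < ε := by
          rw [inv_mul_lt_iff₀ hapos]
          rwa [div_lt_iff₀ hε] at hy'
end
end
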